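/- arXiv:1410.5284 — 2 statements merged into one kernel-verified Lean document; each statement's English description precedes it below -/
import Mathlib

section
/- Let {x_i^k} be the iterates of the incremental Newton (IN) method. Then for every k ≥ 1 and every i = 1,…,m, the inner iterates satisfy the closed-form representation x_{i+1}^k = x_1^k − α^k (H_i^k)^{-1} Σ_{j=1}^i ( ∇f_j(x_j^k) + (1/α^k) ∇²f_j(x_j^k)(x_1^k − x_j^k) ). -/
open Finset Filter Classical

theorem posSemidef_partial_sum {n m : ℕ} {A H : ℕ → Matrix (Fin n) (Fin n) ℝ}
    (h0 : (H 0).PosSemidef) (hA : ∀ i ∈ Finset.Icc 1 m, (A i).PosDef)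
    (hH : ∀ i ∈ Finset.Icc 1 m, H i = H (i - 1) + A i) :
    ∀ i ≤ m, (H i).PosSemidef := by
  intro i
  induction i with
  | zero => exact fun _ => h0
  | succ i ih =>
    intro hi
    have hmem : i + 1 ∈ Finset.Icc 1 m := Finset.mem_Icc.2 ⟨by omega, hi⟩
    rw [hH _ hmem, Nat.add_sub_cancel]
    exact (ih (by omega)).add (hA _ hmem).posSemidef

theorem toEuclideanCLM_mul_apply_of_mul_eq_one {n : ℕ} {A B : Matrix (Fin n) (Fin n) ℝ}
    (h : A * B = 1) (v : EuclideanSpace ℝ (Fin n)) :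
    Matrix.toEuclideanCLM (𝕜 := ℝ) A (Matrix.toEuclideanCLM (𝕜 := ℝ) B v) = v := by
  rw [← mul_apply_eq_comp, ← map_mul, h, map_one, one_apply_eq_self]

theorem smul_sum_eq_partial_sum_apply {n m : ℕ} {A H : ℕ → Matrix (Fin n) (Fin n) ℝ}
    {x g : ℕ → EuclideanSpace ℝ (Fin n)} {a : ℝ} (ha : a ≠ 0)
    (hH : ∀ i ∈ Finset.Icc 1 m, H i = H (i - 1) + A i)
    (hunit : ∀ i ∈ Finset.Icc 1 m, IsUnit (H i).det)
    (hx : ∀ i ∈ Finset.Icc 1 m,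
      x (i + 1) = x i - a • Matrix.toEuclideanCLM (𝕜 := ℝ) (H i)⁻¹ (g i)) :
    ∀ i ≤ m, a • ∑ j ∈ Finset.Icc 1 i,
        (g j + a⁻¹ • Matrix.toEuclideanCLM (𝕜 := ℝ) (A j) (x 1 - x j)) =
      Matrix.toEuclideanCLM (𝕜 := ℝ) (H i) (x 1 - x (i + 1)) := by
  intro i
  induction i with
  | zero => simp
  | succ i ih =>
    intro hi
    have hmem : i + 1 ∈ Finset.Icc 1 m := Finset.mem_Icc.2 ⟨by omega, hi⟩
    have hsplit : x 1 - x (i + 1 + 1) = (x 1 - x (i + 1)) +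
        a • Matrix.toEuclideanCLM (𝕜 := ℝ) (H (i + 1))⁻¹ (g (i + 1)) := by
      rw [hx _ hmem]; abel
    rw [Finset.sum_Icc_succ_top (by omega), smul_add, ih (by omega), hsplit, map_add, map_smul,
      toEuclideanCLM_mul_apply_of_mul_eq_one (Matrix.mul_nonsing_inv _ (hunit _ hmem)),
      smul_add, smul_inv_smul₀ ha, hH _ hmem, Nat.add_sub_cancel, map_add,
      add_apply]
    abel

theorem statement0
    (n m : ℕ) (hm : 1 < m)
    (f : ℕ → EuclideanSpace ℝ (Fin n) → ℝ)
    (g : ℕ → EuclideanSpace ℝ (Fin n) → EuclideanSpace ℝ (Fin n))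
    (hess : ℕ → EuclideanSpace ℝ (Fin n) → Matrix (Fin n) (Fin n) ℝ)
    (hgrad : ∀ i ∈ Finset.Icc 1 m, ∀ y, HasGradientAt (f i) (g i y) y)
    (hhess : ∀ i ∈ Finset.Icc 1 m, ∀ y, HasFDerivAt (g i) (Matrix.toEuclideanCLM (𝕜 := ℝ) (hess i y)) y)
    (hcont : ∀ i ∈ Finset.Icc 1 m, Continuous (hess i))
    (α : ℕ → ℝ) (hα : ∀ k, 1 ≤ k → 0 < α k)
    (x : ℕ → ℕ → EuclideanSpace ℝ (Fin n))
    (H : ℕ → ℕ → Matrix (Fin n) (Fin n) ℝ)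
    (hH0 : H 1 0 = 0)
    (hHnext : ∀ k, 1 ≤ k → H (k+1) 0 = H k m)
    (hHrec : ∀ k, 1 ≤ k → ∀ i ∈ Finset.Icc 1 m, H k i = H k (i-1) + hess i (x k i))
    (hxnext : ∀ k, 1 ≤ k → x (k+1) 1 = x k (m+1))
    (hiter : ∀ k, 1 ≤ k → ∀ i ∈ Finset.Icc 1 m,
      x k (i+1) = x k i - α k • (Matrix.toEuclideanCLM (𝕜 := ℝ) (H k i)⁻¹) (g i (x k i)))
    (hpd : ∀ i ∈ Finset.Icc 1 m, ∀ y, (hess i y).PosDef) :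
    ∀ k, 1 ≤ k → ∀ i ∈ Finset.Icc 1 m,
      x k (i+1) = x k 1 - α k •
        (Matrix.toEuclideanCLM (𝕜 := ℝ) (H k i)⁻¹)
          (∑ j ∈ Finset.Icc 1 i,
            (g j (x k j) + (α k)⁻¹ • (Matrix.toEuclideanCLM (𝕜 := ℝ) (hess j (x k j))) (x k 1 - x k j))) := by
  have hstart : ∀ k, 1 ≤ k → (H k 0).PosSemidef := by
    intro k hk
    induction k, hk using Nat.le_induction with
    | base => rw [hH0]; exact Matrix.PosSemidef.zero
    | succ k hk ih =>
      rw [hHnext k hk]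
      exact posSemidef_partial_sum ih (fun i hi => hpd i hi (x k i)) (hHrec k hk) m le_rfl
  intro k hk i hi
  have hunit : ∀ i ∈ Finset.Icc 1 m, IsUnit (H k i).det := by
    intro i hi
    rw [hHrec k hk i hi]
    have hprev := posSemidef_partial_sum (hstart k hk) (fun i hi => hpd i hi (x k i))
      (hHrec k hk) (i - 1) ((Nat.sub_le i 1).trans (Finset.mem_Icc.1 hi).2)
    exact (Matrix.PosDef.posSemidef_add hprev (hpd i hi (x k i))).det_pos.ne'.isUnit
  rw [← map_smul, smul_sum_eq_partial_sum_apply (g := fun j => g j (x k j)) (hα k hk).ne'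
      (hHrec k hk) hunit (hiter k hk) i (Finset.mem_Icc.1 hi).2,
    toEuclideanCLM_mul_apply_of_mul_eq_one (Matrix.nonsing_inv_mul _ (hunit i hi)),
    sub_sub_cancel]
end

section
/- (Global linear convergence with constant stepsize) Consider the IN iterates with constant normalized stepsize γ^k = γ and suppose Assumptions 1, 2 and 4 hold. Then there exists a constant γ̃ > 0 (depending on M, c, C and m) such that if 0 < γ < γ̃, the iterates are globally linearly convergent: there exist A > 0 and ρ < 1 with ‖x_1^k − x*‖ ≤ A·ρ^k for all k = 1,2,…, where x* is the unique minimizer of f over ℝ^n. -/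
open Finset Filter Classical

section Operator

open Matrix

variable {n : ℕ} {A : Matrix (Fin n) (Fin n) ℝ} {a b : ℝ}

lemma le_inner_of_posSemidef_sub (h : (A - a • 1).PosSemidef) (v : EuclideanSpace ℝ (Fin n)) :
    a * ‖v‖ ^ 2 ≤ inner ℝ v (toEuclideanCLM (𝕜 := ℝ) A v) := by
  have h1 := h.dotProduct_mulVec_nonneg v.ofLp
  rw [star_trivial, ← inner_toEuclideanCLM] at h1
  simpa [inner_sub_right, inner_smul_right] using h1

lemma inner_le_of_posSemidef_sub (h : (b • 1 - A).PosSemidef) (v : EuclideanSpace ℝ (Fin n)) :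
    inner ℝ v (toEuclideanCLM (𝕜 := ℝ) A v) ≤ b * ‖v‖ ^ 2 := by
  have h1 := h.dotProduct_mulVec_nonneg v.ofLp
  rw [star_trivial, ← inner_toEuclideanCLM] at h1
  simpa [inner_sub_right, inner_smul_right] using h1

lemma inner_toEuclideanCLM_comm (hA : A.IsHermitian) (v w : EuclideanSpace ℝ (Fin n)) :
    inner ℝ v (toEuclideanCLM (𝕜 := ℝ) A w) = inner ℝ (toEuclideanCLM (𝕜 := ℝ) A v) w := by
  rw [real_inner_comm w, inner_toEuclideanCLM, inner_toEuclideanCLM, dotProduct_mulVec,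
    dotProduct_comm, ← mulVec_transpose]
  congr 2

lemma norm_sq_toEuclideanCLM_le (hA : A.PosSemidef) (hb : 0 < b) (h : (b • 1 - A).PosSemidef)
    (v : EuclideanSpace ℝ (Fin n)) :
    ‖toEuclideanCLM (𝕜 := ℝ) A v‖ ^ 2 ≤ b * inner ℝ v (toEuclideanCLM (𝕜 := ℝ) A v) := by
  set w := toEuclideanCLM (𝕜 := ℝ) A v with hw
  have h1 : 0 * ‖b • v - w‖ ^ 2 ≤ _ := le_inner_of_posSemidef_sub (by simpa using hA) (b • v - w)
  have h2 := inner_le_of_posSemidef_sub h w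
  have h3 : inner ℝ v (toEuclideanCLM (𝕜 := ℝ) A w) = ‖w‖ ^ 2 := by
    rw [inner_toEuclideanCLM_comm hA.1, real_inner_self_eq_norm_sq]
  simp only [map_sub, map_smul, inner_sub_left, inner_sub_right, inner_smul_left,
    inner_smul_right, ← hw, h3, real_inner_self_eq_norm_sq] at h1
  simp only [conj_trivial, zero_mul] at h1
  have h4 : 0 ≤ b * (b * inner ℝ v w - ‖w‖ ^ 2) := by nlinarith
  linarith [nonneg_of_mul_nonneg_right h4 hb]

lemma norm_toEuclideanCLM_le (hA : A.PosSemidef) (hb : 0 < b) (h : (b • 1 - A).PosSemidef)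
    (v : EuclideanSpace ℝ (Fin n)) :
    ‖toEuclideanCLM (𝕜 := ℝ) A v‖ ≤ b * ‖v‖ := by
  have h1 := norm_sq_toEuclideanCLM_le hA hb h v
  have h2 := inner_le_of_posSemidef_sub h v
  refine le_of_sq_le_sq ?_ (by positivity)
  nlinarith

lemma posDef_of_posSemidef_sub (ha : 0 < a) (h : (A - a • 1).PosSemidef) : A.PosDef := by
  simpa using PosDef.posSemidef_add h (PosDef.one.smul ha)

lemma toEuclideanCLM_apply_inv (ha : 0 < a) (h : (A - a • 1).PosSemidef)
    (v : EuclideanSpace ℝ (Fin n)) :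
    toEuclideanCLM (𝕜 := ℝ) A (toEuclideanCLM (𝕜 := ℝ) A⁻¹ v) = v := by
  have hu := (posDef_of_posSemidef_sub ha h).isUnit
  rw [← mul_apply_eq_comp, ← map_mul,
    mul_nonsing_inv _ ((isUnit_iff_isUnit_det _).1 hu)]
  simp

lemma toEuclideanCLM_inv_apply (ha : 0 < a) (h : (A - a • 1).PosSemidef)
    (v : EuclideanSpace ℝ (Fin n)) :
    toEuclideanCLM (𝕜 := ℝ) A⁻¹ (toEuclideanCLM (𝕜 := ℝ) A v) = v := by
  have hu := (posDef_of_posSemidef_sub ha h).isUnit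
  rw [← mul_apply_eq_comp, ← map_mul,
    nonsing_inv_mul _ ((isUnit_iff_isUnit_det _).1 hu)]
  simp

lemma norm_toEuclideanCLM_inv_le (ha : 0 < a) (h : (A - a • 1).PosSemidef)
    (v : EuclideanSpace ℝ (Fin n)) :
    ‖toEuclideanCLM (𝕜 := ℝ) A⁻¹ v‖ ≤ ‖v‖ / a := by
  set w := toEuclideanCLM (𝕜 := ℝ) A⁻¹ v with hw
  have h1 := le_inner_of_posSemidef_sub h w
  rw [hw, toEuclideanCLM_apply_inv ha h, ← hw] at h1
  have h2 := real_inner_le_norm w v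
  rw [le_div_iff₀ ha]
  rcases (norm_nonneg w).eq_or_lt with h0 | h0
  · simp [← h0]
  · exact le_of_mul_le_mul_left (by nlinarith) h0

lemma le_inner_toEuclideanCLM_inv (ha : 0 < a) (h : (A - a • 1).PosSemidef) (hb : 0 < b)
    (h' : (b • 1 - A).PosSemidef) (v : EuclideanSpace ℝ (Fin n)) :
    ‖v‖ ^ 2 / b ≤ inner ℝ v (toEuclideanCLM (𝕜 := ℝ) A⁻¹ v) := by
  have h1 := norm_sq_toEuclideanCLM_le (posDef_of_posSemidef_sub ha h).posSemidef hb h'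
    (toEuclideanCLM (𝕜 := ℝ) A⁻¹ v)
  rw [toEuclideanCLM_apply_inv ha h, real_inner_comm] at h1
  rwa [div_le_iff₀' hb]

lemma norm_toEuclideanCLM_inv_sub_inv_le {B : Matrix (Fin n) (Fin n) ℝ} {r : ℝ} (ha : 0 < a)
    (hr : 0 ≤ r) (hA : (A - a • 1).PosSemidef) (hB : (B - a • 1).PosSemidef)
    (hAB : ∀ v, ‖toEuclideanCLM (𝕜 := ℝ) (B - A) v‖ ≤ r * ‖v‖) (v : EuclideanSpace ℝ (Fin n)) :
    ‖toEuclideanCLM (𝕜 := ℝ) A⁻¹ v - toEuclideanCLM (𝕜 := ℝ) B⁻¹ v‖ ≤ r / a ^ 2 * ‖v‖ := by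
  set w := toEuclideanCLM (𝕜 := ℝ) B⁻¹ v with hw
  have hv : v = toEuclideanCLM (𝕜 := ℝ) B w := (toEuclideanCLM_apply_inv ha hB v).symm
  have h1 : toEuclideanCLM (𝕜 := ℝ) A⁻¹ v - w
      = toEuclideanCLM (𝕜 := ℝ) A⁻¹ (toEuclideanCLM (𝕜 := ℝ) (B - A) w) := by
    rw [map_sub, _root_.sub_apply, map_sub, ← hv, toEuclideanCLM_inv_apply ha hA]
  calc ‖toEuclideanCLM (𝕜 := ℝ) A⁻¹ v - w‖
      ≤ ‖toEuclideanCLM (𝕜 := ℝ) (B - A) w‖ / a := h1 ▸ norm_toEuclideanCLM_inv_le ha hA _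
    _ ≤ r * (‖v‖ / a) / a := by
        gcongr
        exact (hAB w).trans (by gcongr; exact norm_toEuclideanCLM_inv_le ha hB v)
    _ = r / a ^ 2 * ‖v‖ := by field_simp

end Operator

section Gradient

variable {E : Type*} [NormedAddCommGroup E] [InnerProductSpace ℝ E]

lemma norm_sub_le_of_hasFDerivAt {g : E → E} {T : E → E →L[ℝ] E} {C : ℝ}
    (hC : 0 ≤ C) (hg : ∀ y, HasFDerivAt g (T y) y) (hT : ∀ y v, ‖T y v‖ ≤ C * ‖v‖) (x y : E) :
    ‖g y - g x‖ ≤ C * ‖y - x‖ :=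
  convex_univ.norm_image_sub_le_of_norm_hasFDerivWithin_le
    (fun z _ => (hg z).hasFDerivWithinAt) (fun z _ => (T z).opNorm_le_bound hC (hT z))
    (Set.mem_univ x) (Set.mem_univ y)

lemma le_inner_sub_of_hasFDerivAt {g : E → E} {T : E → E →L[ℝ] E} {c : ℝ}
    (hg : ∀ y, HasFDerivAt g (T y) y) (hT : ∀ y v, c * ‖v‖ ^ 2 ≤ inner ℝ v (T y v)) (x y : E) :
    c * ‖y - x‖ ^ 2 ≤ inner ℝ (y - x) (g y - g x) := by
  obtain ⟨z, -, hz⟩ := domain_mvt (f := fun z => inner ℝ (y - x) (g z)) (s := Set.univ)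
    (x := x) (y := y) (f' := fun z => (innerSL ℝ (y - x)).comp (T z))
    (fun z _ => ((innerSL ℝ (y - x)).hasFDerivAt.comp z (hg z)).hasFDerivWithinAt)
    convex_univ (Set.mem_univ _) (Set.mem_univ _)
  rw [inner_sub_right, hz]
  exact hT z (y - x)

variable [CompleteSpace E] {F : E → ℝ} {G : E → E} {L : ℝ}

lemma le_add_inner_add_of_lipschitz_gradient (hL : 0 ≤ L) (hF : ∀ y, HasGradientAt F (G y) y)
    (hG : ∀ x y, ‖G y - G x‖ ≤ L * ‖y - x‖) (x y : E) :
    F y ≤ F x + inner ℝ (G x) (y - x) + L * ‖y - x‖ ^ 2 := by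
  obtain ⟨z, hz, h⟩ := domain_mvt (f := F) (s := Set.univ) (x := x) (y := y)
    (fun z _ => (hF z).hasFDerivAt.hasFDerivWithinAt) convex_univ (Set.mem_univ _) (Set.mem_univ _)
  have hzx : ‖z - x‖ ≤ ‖y - x‖ := by
    obtain ⟨t, ⟨ht0, ht1⟩, rfl⟩ := segment_eq_image' ℝ x y ▸ hz
    rw [add_sub_cancel_left, norm_smul, Real.norm_of_nonneg ht0]
    exact mul_le_of_le_one_left (norm_nonneg _) ht1
  have h1 : F y - F x = inner ℝ (G z) (y - x) := h
  have h2 := real_inner_le_norm (G z - G x) (y - x)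
  have h3 : ‖G z - G x‖ * ‖y - x‖ ≤ L * ‖y - x‖ * ‖y - x‖ := by
    gcongr
    exact (hG x z).trans (by gcongr)
  rw [inner_sub_left] at h2
  linarith

lemma norm_sq_gradient_le (hL : 0 < L) (hF : ∀ y, HasGradientAt F (G y) y)
    (hG : ∀ x y, ‖G y - G x‖ ≤ L * ‖y - x‖) {xstar : E} (hmin : ∀ y, F xstar ≤ F y) (x : E) :
    ‖G x‖ ^ 2 ≤ 4 * L * (F x - F xstar) := by
  have h1 := le_add_inner_add_of_lipschitz_gradient hL.le hF hG x (x - (1 / (2 * L)) • G x)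
  have h2 := hmin (x - (1 / (2 * L)) • G x)
  rw [sub_sub_cancel_left, inner_neg_right, inner_smul_right, real_inner_self_eq_norm_sq,
    norm_neg, norm_smul, Real.norm_of_nonneg (by positivity)] at h1
  have h3 : F x + -(1 / (2 * L) * ‖G x‖ ^ 2) + L * (1 / (2 * L) * ‖G x‖) ^ 2
      = F x - ‖G x‖ ^ 2 / (4 * L) := by
    field_simp
    ring
  have h4 : ‖G x‖ ^ 2 / (4 * L) ≤ F x - F xstar := by linarith
  rwa [div_le_iff₀' (by positivity)] at h4

lemma gradient_eq_zero_of_forall_le (hF : ∀ y, HasGradientAt F (G y) y) {xstar : E}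
    (hmin : ∀ y, F xstar ≤ F y) : G xstar = 0 := by
  have h : IsLocalMin F xstar := Eventually.of_forall hmin
  simpa using h.hasFDerivAt_eq_zero (hF xstar).hasFDerivAt

lemma mul_norm_sub_le_norm_gradient {μ : ℝ} (hF : ∀ y, HasGradientAt F (G y) y)
    (hG : ∀ x y, μ * ‖y - x‖ ^ 2 ≤ inner ℝ (y - x) (G y - G x)) {xstar : E}
    (hmin : ∀ y, F xstar ≤ F y) (x : E) : μ * ‖x - xstar‖ ≤ ‖G x‖ := by
  have h1 := hG xstar x
  rw [gradient_eq_zero_of_forall_le hF hmin, sub_zero] at h1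
  have h2 := real_inner_le_norm (x - xstar) (G x)
  rcases (norm_nonneg (x - xstar)).eq_or_lt with h0 | h0
  · simp [← h0]
  · exact le_of_mul_le_mul_left (by nlinarith) h0

end Gradient

section HessianSums

open Matrix

variable {n m : ℕ} {H D : ℕ → ℕ → Matrix (Fin n) (Fin n) ℝ}

lemma posSemidef_sub_of_accumulated {a : ℝ}
    (hH0 : H 1 0 = 0) (hHm : ∀ k, 1 ≤ k → H (k + 1) 0 = H k m)
    (hH : ∀ k, 1 ≤ k → ∀ i ∈ Finset.Icc 1 m, H k i = H k (i - 1) + D k i)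
    (hD : ∀ k, 1 ≤ k → ∀ i ∈ Finset.Icc 1 m, (D k i - a • 1).PosSemidef) (k : ℕ) :
    ∀ i ≤ m, (H (k + 1) i - (a * (k * m + i)) • 1).PosSemidef := by
  have step (k : ℕ) (h0 : (H (k + 1) 0 - (a * (k * m)) • 1).PosSemidef) :
      ∀ i ≤ m, (H (k + 1) i - (a * (k * m + i)) • 1).PosSemidef := by
    intro i
    induction i with
    | zero => simpa using h0
    | succ i ih =>
      intro hi
      have hmem : i + 1 ∈ Finset.Icc 1 m := by simp; omega
      convert (ih (by omega)).add (hD (k + 1) (by omega) _ hmem) using 1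
      rw [hH (k + 1) (by omega) _ hmem]
      push_cast
      module
  induction k with
  | zero => exact step 0 (by simpa [hH0] using PosSemidef.zero)
  | succ k ih =>
    refine step (k + 1) ?_
    rw [hHm (k + 1) (by omega)]
    convert ih m le_rfl using 3
    push_cast
    ring

lemma posSemidef_smul_one_sub_of_accumulated {b : ℝ}
    (hH0 : H 1 0 = 0) (hHm : ∀ k, 1 ≤ k → H (k + 1) 0 = H k m)
    (hH : ∀ k, 1 ≤ k → ∀ i ∈ Finset.Icc 1 m, H k i = H k (i - 1) + D k i)
    (hD : ∀ k, 1 ≤ k → ∀ i ∈ Finset.Icc 1 m, (b • 1 - D k i).PosSemidef) (k i : ℕ) (hi : i ≤ m) :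
    ((b * (k * m + i)) • 1 - H (k + 1) i).PosSemidef := by
  have h := posSemidef_sub_of_accumulated (H := -H) (D := -D) (a := -b) (m := m) (by simp [hH0])
    (fun k hk => by simp [hHm k hk])
    (fun k hk i hi => by simp only [Pi.neg_apply]; rw [hH k hk i hi]; abel)
    (fun k hk i hi => by
      convert hD k hk i hi using 1
      simp only [Pi.neg_apply]
      module) k i hi
  convert h using 1
  simp only [Pi.neg_apply]
  module

lemma norm_toEuclideanCLM_accumulated_sub_le {C : ℝ} {H D : ℕ → Matrix (Fin n) (Fin n) ℝ}
    (hH : ∀ i ∈ Finset.Icc 1 m, H i = H (i - 1) + D i)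
    (hD : ∀ i ∈ Finset.Icc 1 m, ∀ v, ‖toEuclideanCLM (𝕜 := ℝ) (D i) v‖ ≤ C * ‖v‖) (i : ℕ)
    (v : EuclideanSpace ℝ (Fin n)) (d : ℕ) (hd : i + d ≤ m) :
    ‖toEuclideanCLM (𝕜 := ℝ) (H (i + d) - H i) v‖ ≤ d * C * ‖v‖ := by
  induction d with
  | zero => simp
  | succ d ih =>
    have hmem : i + (d + 1) ∈ Finset.Icc 1 m := by simp; omega
    have h1 : H (i + (d + 1)) - H i = (H (i + d) - H i) + D (i + (d + 1)) := by
      rw [hH _ hmem, show i + (d + 1) - 1 = i + d by omega]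
      abel
    rw [h1, map_add, _root_.add_apply]
    push_cast
    linarith [norm_add_le (toEuclideanCLM (𝕜 := ℝ) (H (i + d) - H i) v)
      (toEuclideanCLM (𝕜 := ℝ) (D (i + (d + 1))) v), ih (by omega), hD _ hmem v]

end HessianSums

section Cycle

variable {E : Type*} [NormedAddCommGroup E] {m : ℕ} {g : ℕ → E → E} {C : ℝ}

lemma norm_sum_sub_sum_le (hlip : ∀ i ∈ Finset.Icc 1 m, ∀ x y, ‖g i y - g i x‖ ≤ C * ‖y - x‖)
    (x y : E) :
    ‖∑ i ∈ Finset.Icc 1 m, g i y - ∑ i ∈ Finset.Icc 1 m, g i x‖ ≤ m * C * ‖y - x‖ := by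
  rw [← Finset.sum_sub_distrib]
  refine (norm_sum_le_of_le _ fun i hi => hlip i hi x y).trans (le_of_eq ?_)
  simp [mul_assoc]

variable [NormedSpace ℝ E] {M β ε K : ℝ} {P : ℕ → E →L[ℝ] E} {Q : E →L[ℝ] E} {x : ℕ → E}

lemma incremental_drift_le (hC : 0 ≤ C) (hM : 0 ≤ M) (hβ : 0 ≤ β)
    (hlip : ∀ i ∈ Finset.Icc 1 m, ∀ x y, ‖g i y - g i x‖ ≤ C * ‖y - x‖)
    (hgg : ∀ i ∈ Finset.Icc 1 m, ∀ y, ‖g i y‖ ≤ M * ‖∑ j ∈ Finset.Icc 1 m, g j y‖)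
    (hP : ∀ i ∈ Finset.Icc 1 m, ∀ v, ‖P i v‖ ≤ β * ‖v‖)
    (hx : ∀ i ∈ Finset.Icc 1 m, x (i + 1) = x i - P i (g i (x i)))
    (hK : (1 + β * M * (m * C)) ^ m ≤ K) :
    ∀ j ≤ m, ‖x (j + 1) - x 1‖ ≤ j * (β * M * K * ‖∑ i ∈ Finset.Icc 1 m, g i (x 1)‖) ∧
      ‖∑ i ∈ Finset.Icc 1 m, g i (x (j + 1))‖ ≤ K * ‖∑ i ∈ Finset.Icc 1 m, g i (x 1)‖ := by
  set G := ‖∑ i ∈ Finset.Icc 1 m, g i (x 1)‖ with hG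
  have hG0 : 0 ≤ G := norm_nonneg _
  have hr : 0 ≤ β * M * (m * C) := by positivity
  have hsum (j : ℕ) : ‖∑ i ∈ Finset.Icc 1 m, g i (x j)‖ ≤ G + m * C * ‖x j - x 1‖ :=
    (norm_le_norm_add_norm_sub' _ _).trans (by gcongr; exact norm_sum_sub_sum_le hlip _ _)
  have hstep (j : ℕ) (hj : j + 1 ≤ m) :
      ‖x (j + 1 + 1) - x 1‖ ≤ ‖x (j + 1) - x 1‖ +
        β * (M * ‖∑ i ∈ Finset.Icc 1 m, g i (x (j + 1))‖) := by
    have hmem : j + 1 ∈ Finset.Icc 1 m := by simp; omega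
    rw [hx _ hmem, sub_right_comm]
    refine (norm_sub_le _ _).trans ?_
    gcongr
    exact (hP _ hmem _).trans (by gcongr; exact hgg _ hmem _)
  have hpow (j : ℕ) : j ≤ m →
      G + m * C * ‖x (j + 1) - x 1‖ ≤ (1 + β * M * (m * C)) ^ j * G := by
    induction j with
    | zero => simp
    | succ j ih =>
      intro hj
      calc G + m * C * ‖x (j + 1 + 1) - x 1‖
          ≤ G + m * C * (‖x (j + 1) - x 1‖ + β * (M * (G + m * C * ‖x (j + 1) - x 1‖))) := by
            gcongr
            exact (hstep j hj).trans (by gcongr; exact hsum _)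
        _ = (1 + β * M * (m * C)) * (G + m * C * ‖x (j + 1) - x 1‖) := by ring
        _ ≤ (1 + β * M * (m * C)) * ((1 + β * M * (m * C)) ^ j * G) := by
            gcongr
            exact ih (by omega)
        _ = _ := by ring
  have hbound (j : ℕ) (hj : j ≤ m) : ‖∑ i ∈ Finset.Icc 1 m, g i (x (j + 1))‖ ≤ K * G := by
    refine (hsum _).trans ((hpow j hj).trans ?_)
    gcongr
    exact (pow_le_pow_right₀ (by linarith) hj).trans hK
  intro j hj
  refine ⟨?_, hbound j hj⟩
  induction j with
  | zero => simp
  | succ j ih =>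
    have h : β * (M * ‖∑ i ∈ Finset.Icc 1 m, g i (x (j + 1))‖) ≤ β * (M * (K * G)) := by
      gcongr
      exact hbound j (by omega)
    push_cast
    linarith [hstep j hj, ih (by omega)]

lemma incremental_error_le (hC : 0 ≤ C) (hM : 0 ≤ M) (hβ : 0 ≤ β) (hε : 0 ≤ ε)
    (hlip : ∀ i ∈ Finset.Icc 1 m, ∀ x y, ‖g i y - g i x‖ ≤ C * ‖y - x‖)
    (hgg : ∀ i ∈ Finset.Icc 1 m, ∀ y, ‖g i y‖ ≤ M * ‖∑ j ∈ Finset.Icc 1 m, g j y‖)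
    (hP : ∀ i ∈ Finset.Icc 1 m, ∀ v, ‖P i v‖ ≤ β * ‖v‖)
    (hQ : ∀ v, ‖Q v‖ ≤ β * ‖v‖)
    (hPQ : ∀ i ∈ Finset.Icc 1 m, ∀ v, ‖P i v - Q v‖ ≤ ε * ‖v‖)
    (hx : ∀ i ∈ Finset.Icc 1 m, x (i + 1) = x i - P i (g i (x i)))
    (hK : (1 + β * M * (m * C)) ^ m ≤ K) :
    ‖x (m + 1) - x 1 + Q (∑ i ∈ Finset.Icc 1 m, g i (x 1))‖ ≤
      m * (ε * M * K + β * C * (m * (β * M * K))) * ‖∑ i ∈ Finset.Icc 1 m, g i (x 1)‖ := by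
  have hdrift := incremental_drift_le hC hM hβ hlip hgg hP hx hK
  set G := ‖∑ i ∈ Finset.Icc 1 m, g i (x 1)‖ with hG
  have hK0 : 0 ≤ K := le_trans (by positivity) hK
  have key (j : ℕ) : j ≤ m → ‖x (j + 1) - x 1 + Q (∑ i ∈ Finset.Icc 1 j, g i (x 1))‖ ≤
      j * (ε * M * K + β * C * (m * (β * M * K))) * G := by
    induction j with
    | zero => simp
    | succ j ih =>
      intro hj
      have hmem : j + 1 ∈ Finset.Icc 1 m := by simp; omega
      obtain ⟨h1, h2⟩ := hdrift j (by omega)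
      have h3 : ‖P (j + 1) (g (j + 1) (x (j + 1))) - Q (g (j + 1) (x (j + 1)))‖
          ≤ ε * (M * (K * G)) :=
        (hPQ _ hmem _).trans (by gcongr; exact (hgg _ hmem _).trans (by gcongr))
      have h4 : ‖Q (g (j + 1) (x (j + 1)) - g (j + 1) (x 1))‖
          ≤ β * (C * (m * (β * M * K * G))) := by
        refine (hQ _).trans ?_
        gcongr
        refine (hlip _ hmem _ _).trans ?_
        gcongr
        refine h1.trans ?_
        gcongr
        omega
      have h5 : x (j + 1 + 1) - x 1 + Q (∑ i ∈ Finset.Icc 1 (j + 1), g i (x 1))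
          = (x (j + 1) - x 1 + Q (∑ i ∈ Finset.Icc 1 j, g i (x 1)))
            - (P (j + 1) (g (j + 1) (x (j + 1))) - Q (g (j + 1) (x (j + 1))))
            - Q (g (j + 1) (x (j + 1)) - g (j + 1) (x 1)) := by
        rw [hx _ hmem, Finset.sum_Icc_succ_top (by omega), map_add, map_sub]
        abel
      rw [h5]
      refine (norm_sub_le _ _).trans ((add_le_add ((norm_sub_le _ _).trans
        (add_le_add (ih (by omega)) h3)) h4).trans (le_of_eq ?_))
      push_cast
      ring
  exact key m le_rfl

end Cycle

lemma exists_le_mul_pow_of_eventually_le {V : ℕ → ℝ} {q : ℝ} (hq : 0 < q) {k₀ : ℕ}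
    (h : ∀ k, k₀ ≤ k → V (k + 1) ≤ q * V k) : ∃ B : ℝ, 0 < B ∧ ∀ k, V k ≤ B * q ^ k := by
  have hS : 0 ≤ ∑ j ∈ Finset.range (k₀ + 1), |V j| / q ^ j := by positivity
  refine ⟨∑ j ∈ Finset.range (k₀ + 1), |V j| / q ^ j + 1, by linarith, fun k => ?_⟩
  have hinit : ∀ k ≤ k₀, V k ≤ (∑ j ∈ Finset.range (k₀ + 1), |V j| / q ^ j + 1) * q ^ k := by
    intro k hk
    have h1 : |V k| / q ^ k ≤ ∑ j ∈ Finset.range (k₀ + 1), |V j| / q ^ j :=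
      Finset.single_le_sum (f := fun j => |V j| / q ^ j) (fun j _ => by positivity)
        (Finset.mem_range.2 (by omega))
    exact (le_abs_self _).trans ((div_le_iff₀ (by positivity)).1 (by linarith))
  rcases le_total k k₀ with hk | hk
  · exact hinit k hk
  · induction k, hk using Nat.le_induction with
    | base => exact hinit k₀ le_rfl
    | succ k hk ih =>
      calc V (k + 1) ≤ q * V k := h k hk
        _ ≤ q * (_ * q ^ k) := by gcongr
        _ = _ := by ring

lemma mul_gap_le_mul_norm_sq_gradient {E : Type*} [NormedAddCommGroup E] [InnerProductSpace ℝ E]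
    [CompleteSpace E] {F : E → ℝ} {G : E → E} {L μ : ℝ} (hL : 0 ≤ L) (hμ : 0 ≤ μ)
    (hF : ∀ y, HasGradientAt F (G y) y) (hG : ∀ x y, ‖G y - G x‖ ≤ L * ‖y - x‖)
    (hG' : ∀ x y, μ * ‖y - x‖ ^ 2 ≤ inner ℝ (y - x) (G y - G x)) {xstar : E}
    (hmin : ∀ y, F xstar ≤ F y) (x : E) : μ ^ 2 * (F x - F xstar) ≤ L * ‖G x‖ ^ 2 := by
  have h1 := le_add_inner_add_of_lipschitz_gradient hL hF hG xstar x
  rw [gradient_eq_zero_of_forall_le hF hmin, inner_zero_left, add_zero] at h1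
  have h2 : (μ * ‖x - xstar‖) ^ 2 ≤ ‖G x‖ ^ 2 := by
    gcongr
    exact mul_norm_sub_le_norm_gradient hF hG' hmin x
  calc μ ^ 2 * (F x - F xstar) ≤ μ ^ 2 * (L * ‖x - xstar‖ ^ 2) := by gcongr; linarith
    _ = L * (μ * ‖x - xstar‖) ^ 2 := by ring
    _ ≤ L * ‖G x‖ ^ 2 := by gcongr

/-- One inexact preconditioned gradient step contracts the optimality gap. -/
lemma gap_contraction {E : Type*} [NormedAddCommGroup E] [InnerProductSpace ℝ E]
    [CompleteSpace E] {F : E → ℝ} {G : E → E} {L μ : ℝ} (hL : 0 < L) (hμ : 0 < μ)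
    (hF : ∀ y, HasGradientAt F (G y) y) (hG : ∀ x y, ‖G y - G x‖ ≤ L * ‖y - x‖)
    (hG' : ∀ x y, μ * ‖y - x‖ ^ 2 ≤ inner ℝ (y - x) (G y - G x)) {xstar : E}
    (hmin : ∀ y, F xstar ≤ F y) {x y p : E} {γ η δ : ℝ} (hγ : 0 < γ)
    (hp : γ / L * ‖G x‖ ^ 2 ≤ inner ℝ (G x) p)
    (herr : ‖y - x + p‖ ≤ η * ‖G x‖) (hstep : ‖y - x‖ ≤ δ * ‖G x‖)
    (hsmall : η + L * δ ^ 2 ≤ γ / (2 * L)) :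
    F y - F xstar ≤ (1 - γ * μ ^ 2 / (2 * L ^ 2)) * (F x - F xstar) := by
  have h1 := le_add_inner_add_of_lipschitz_gradient hL.le hF hG x y
  have h2 : inner ℝ (G x) (y - x + p) ≤ η * ‖G x‖ ^ 2 :=
    calc _ ≤ ‖G x‖ * ‖y - x + p‖ := real_inner_le_norm _ _
      _ ≤ ‖G x‖ * (η * ‖G x‖) := by gcongr
      _ = _ := by ring
  rw [inner_add_right] at h2
  have h3 : L * ‖y - x‖ ^ 2 ≤ L * (δ * ‖G x‖) ^ 2 := by gcongr
  have h4 : (η + L * δ ^ 2) * ‖G x‖ ^ 2 ≤ γ / (2 * L) * ‖G x‖ ^ 2 := by gcongr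
  have h5 : γ / L * ‖G x‖ ^ 2 = 2 * (γ / (2 * L) * ‖G x‖ ^ 2) := by field_simp
  have h6 : γ / (2 * L ^ 2) * (μ ^ 2 * (F x - F xstar)) ≤ γ / (2 * L ^ 2) * (L * ‖G x‖ ^ 2) :=
    mul_le_mul_of_nonneg_left (mul_gap_le_mul_norm_sq_gradient hL.le hμ.le hF hG hG' hmin x)
      (by positivity)
  have h7 : γ / (2 * L ^ 2) * (L * ‖G x‖ ^ 2) = γ / (2 * L) * ‖G x‖ ^ 2 := by field_simp
  have h8 : γ / (2 * L ^ 2) * (μ ^ 2 * (F x - F xstar))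
      = γ * μ ^ 2 / (2 * L ^ 2) * (F x - F xstar) := by ring
  linarith

theorem statement11
    (n m : ℕ) (hm : 1 < m)
    (f : ℕ → EuclideanSpace ℝ (Fin n) → ℝ)
    (g : ℕ → EuclideanSpace ℝ (Fin n) → EuclideanSpace ℝ (Fin n))
    (hess : ℕ → EuclideanSpace ℝ (Fin n) → Matrix (Fin n) (Fin n) ℝ)
    (hgrad : ∀ i ∈ Finset.Icc 1 m, ∀ y, HasGradientAt (f i) (g i y) y)
    (hhess : ∀ i ∈ Finset.Icc 1 m, ∀ y, HasFDerivAt (g i) (Matrix.toEuclideanCLM (𝕜 := ℝ) (hess i y)) y)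
    (hcont : ∀ i ∈ Finset.Icc 1 m, Continuous (hess i))
    (c C : ℝ) (hc : 0 < c) (hcC : c ≤ C)
    (hlb : ∀ i ∈ Finset.Icc 1 m, ∀ y, (hess i y - c • 1).PosSemidef)
    (hub : ∀ i ∈ Finset.Icc 1 m, ∀ y, (C • (1 : Matrix (Fin n) (Fin n) ℝ) - hess i y).PosSemidef)
    (M : ℝ) (hM : 0 < M)
    (hgg : ∀ i ∈ Finset.Icc 1 m, ∀ y, ‖g i y‖ ≤ M * ‖∑ j ∈ Finset.Icc 1 m, g j y‖)
    (X : Set (EuclideanSpace ℝ (Fin n))) (hX : IsCompact X)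
    (xstar : EuclideanSpace ℝ (Fin n))
    (hmin : ∀ y, ∑ i ∈ Finset.Icc 1 m, f i xstar ≤ ∑ i ∈ Finset.Icc 1 m, f i y) :
    ∃ γtilde : ℝ, 0 < γtilde ∧
      ∀ γ : ℝ, 0 < γ → γ < γtilde →
      ∀ (α : ℕ → ℝ) (x : ℕ → ℕ → EuclideanSpace ℝ (Fin n)) (H : ℕ → ℕ → Matrix (Fin n) (Fin n) ℝ),
        (∀ k, 1 ≤ k → α k = γ * k) →
        H 1 0 = 0 →
        (∀ k, 1 ≤ k → H (k+1) 0 = H k m) →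
        (∀ k, 1 ≤ k → ∀ i ∈ Finset.Icc 1 m, H k i = H k (i-1) + hess i (x k i)) →
        (∀ k, 1 ≤ k → x (k+1) 1 = x k (m+1)) →
        (∀ k, 1 ≤ k → ∀ i ∈ Finset.Icc 1 m,
          x k (i+1) = x k i - α k • (Matrix.toEuclideanCLM (𝕜 := ℝ) (H k i)⁻¹) (g i (x k i))) →
        (∀ k, 1 ≤ k → ∀ i ∈ Finset.Icc 1 m, x k i ∈ X) →
        ∃ A ρ : ℝ, 0 < A ∧ 0 < ρ ∧ ρ < 1 ∧
          ∀ k, 1 ≤ k → ‖x k 1 - xstar‖ ≤ A * ρ ^ k := by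
  have hm0 : (0 : ℝ) < m := by exact_mod_cast (by omega : 0 < m)
  have hC : 0 < C := hc.trans_le hcC
  have hpsd : ∀ i ∈ Finset.Icc 1 m, ∀ y, (hess i y).PosSemidef := fun i hi y =>
    (posDef_of_posSemidef_sub hc (hlb i hi y)).posSemidef
  have hhessC : ∀ i ∈ Finset.Icc 1 m, ∀ y v,
      ‖Matrix.toEuclideanCLM (𝕜 := ℝ) (hess i y) v‖ ≤ C * ‖v‖ := fun i hi y v =>
    norm_toEuclideanCLM_le (hpsd i hi y) hC (hub i hi y) v
  have hlip : ∀ i ∈ Finset.Icc 1 m, ∀ x y, ‖g i y - g i x‖ ≤ C * ‖y - x‖ := fun i hi =>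
    norm_sub_le_of_hasFDerivAt hC.le (hhess i hi) (hhessC i hi)
  have hFgrad : ∀ y, HasGradientAt (fun y => ∑ i ∈ Finset.Icc 1 m, f i y)
      (∑ i ∈ Finset.Icc 1 m, g i y) y := fun y => by
    rw [hasGradientAt_iff_hasFDerivAt, map_sum]
    exact HasFDerivAt.fun_sum fun i hi => (hgrad i hi y).hasFDerivAt
  have hGlip := norm_sum_sub_sum_le hlip
  have hGmono : ∀ x y, m * c * ‖y - x‖ ^ 2 ≤
      inner ℝ (y - x) (∑ i ∈ Finset.Icc 1 m, g i y - ∑ i ∈ Finset.Icc 1 m, g i x) := by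
    intro x y
    rw [← Finset.sum_sub_distrib, inner_sum]
    have := Finset.card_nsmul_le_sum (Finset.Icc 1 m)
      (fun i => inner ℝ (y - x) (g i y - g i x)) _ fun i hi =>
        le_inner_sub_of_hasFDerivAt (hhess i hi)
          (fun z v => le_inner_of_posSemidef_sub (hlb i hi z) v) x y
    simpa [mul_assoc] using this
  set L : ℝ := m * C with hLdef
  have hL : 0 < L := by positivity
  have hμ : 0 < m * c := by positivity
  set K : ℝ := (1 + M / c * L) ^ m with hKdef
  have hK : 0 < K := by positivity
  set D₁ : ℝ := m * (L / c ^ 2 * M * K) with hD₁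
  set D₂ : ℝ := m * (1 / c * C * (m * (1 / c * M * K))) with hD₂
  set D₃ : ℝ := m * (1 / c * M * K) with hD₃
  have hD : 0 < D₂ + L * D₃ ^ 2 := by positivity
  refine ⟨min 1 (1 / (4 * L * (D₂ + L * D₃ ^ 2))), by positivity, ?_⟩
  intro γ hγ hγt α x H hα hH0 hHm hH hx1 hx _
  have hγ1 : γ < 1 := hγt.trans_le (min_le_left _ _)
  have hγD : γ * (D₂ + L * D₃ ^ 2) ≤ 1 / (4 * L) := by
    have h := (hγt.trans_le (min_le_right _ _)).le
    rw [le_div_iff₀ (by positivity)] at h ⊢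
    linarith
  have hlow := posSemidef_sub_of_accumulated hH0 hHm hH (fun k _ i hi => hlb i hi (x k i))
  have hupp := posSemidef_smul_one_sub_of_accumulated hH0 hHm hH
    (fun k _ i hi => hub i hi (x k i))
  obtain ⟨k₀, hk₀⟩ := exists_nat_ge (4 * L * D₁)
  have hdecr : ∀ k, k₀ + 1 ≤ k →
      ∑ i ∈ Finset.Icc 1 m, f i (x (k + 1) 1) - ∑ i ∈ Finset.Icc 1 m, f i xstar ≤
        (1 - γ * (m * c) ^ 2 / (2 * L ^ 2)) *
          (∑ i ∈ Finset.Icc 1 m, f i (x k 1) - ∑ i ∈ Finset.Icc 1 m, f i xstar) := by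
    intro k hk
    obtain ⟨k, rfl⟩ : ∃ j, k = j + 1 := ⟨k - 1, by omega⟩
    have hk1 : 1 ≤ k + 1 := by omega
    have hkpos : (0 : ℝ) < k + 1 := by positivity
    have hαk : α (k + 1) = γ * (k + 1) := by rw [hα _ hk1]; push_cast; ring
    have hlow' : ∀ i ∈ Finset.Icc 1 m, (H (k + 1) i - (c * (k + 1)) • 1).PosSemidef := by
      intro i hi
      obtain ⟨hi1, hi2⟩ := Finset.mem_Icc.1 hi
      have h : (0 : ℝ) ≤ c * (k * m + i) - c * (k + 1) := by
        have h1 : (k : ℝ) * 1 ≤ k * m := by gcongr; exact_mod_cast hm.le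
        have h2 : (1 : ℝ) ≤ i := by exact_mod_cast hi1
        nlinarith
      convert (hlow k i hi2).add (Matrix.PosSemidef.one.smul h) using 1
      module
    have hmm : m ∈ Finset.Icc 1 m := by simp; omega
    have hck : 0 < c * ((k : ℝ) + 1) := by positivity
    have hupp' : ((L * (k + 1)) • 1 - H (k + 1) m).PosSemidef := by
      convert hupp k m le_rfl using 3
      rw [hLdef]
      ring
    have hinv : ∀ i ∈ Finset.Icc 1 m, ∀ v,
        ‖(α (k + 1) • Matrix.toEuclideanCLM (𝕜 := ℝ) (H (k + 1) i)⁻¹) v‖ ≤ γ / c * ‖v‖ := by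
      intro i hi v
      rw [smul_apply, norm_smul, hαk, Real.norm_of_nonneg (by positivity)]
      calc γ * (k + 1) * _ ≤ γ * (k + 1) * (‖v‖ / (c * (k + 1))) := by
            gcongr
            exact norm_toEuclideanCLM_inv_le hck (hlow' i hi) v
        _ = γ / c * ‖v‖ := by field_simp
    have hinvsub : ∀ i ∈ Finset.Icc 1 m, ∀ v,
        ‖(α (k + 1) • Matrix.toEuclideanCLM (𝕜 := ℝ) (H (k + 1) i)⁻¹) v -
          (α (k + 1) • Matrix.toEuclideanCLM (𝕜 := ℝ) (H (k + 1) m)⁻¹) v‖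
          ≤ γ * (L / c ^ 2) / (k + 1) * ‖v‖ := by
      intro i hi v
      obtain ⟨hi1, hi2⟩ := Finset.mem_Icc.1 hi
      rw [smul_apply, smul_apply, ← smul_sub, norm_smul, hαk, Real.norm_of_nonneg (by positivity)]
      have hdiff : ∀ v, ‖Matrix.toEuclideanCLM (𝕜 := ℝ) (H (k + 1) m - H (k + 1) i) v‖
          ≤ L * ‖v‖ := by
        intro v
        have h := norm_toEuclideanCLM_accumulated_sub_le (hH (k + 1) hk1)
          (fun i hi => hhessC i hi (x (k + 1) i)) i v (m - i) (by omega)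
        rw [Nat.add_sub_cancel' hi2] at h
        refine h.trans ?_
        rw [hLdef]
        gcongr
        omega
      calc γ * (k + 1) * _ ≤ γ * (k + 1) * (L / (c * (k + 1)) ^ 2 * ‖v‖) := by
            gcongr
            exact norm_toEuclideanCLM_inv_sub_inv_le hck hL.le (hlow' i hi) (hlow' m hmm) hdiff v
        _ = γ * (L / c ^ 2) / (k + 1) * ‖v‖ := by field_simp
    have hKle : (1 + γ / c * M * (m * C)) ^ m ≤ K := by
      rw [hKdef, div_mul_eq_mul_div, ← hLdef]
      gcongr
      exact mul_le_of_le_one_left hM.le hγ1.le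
    have hdrift := (incremental_drift_le hC.le hM.le (by positivity) hlip hgg hinv
      (hx (k + 1) hk1) hKle m le_rfl).1
    have herr := incremental_error_le hC.le hM.le (by positivity) (by positivity) hlip hgg hinv
      (hinv m hmm) hinvsub (hx (k + 1) hk1) hKle
    rw [hx1 (k + 1) hk1]
    refine gap_contraction (δ := γ * D₃) (η := γ * (D₁ / (k + 1)) + γ ^ 2 * D₂) hL hμ hFgrad hGlip
      hGmono hmin hγ ?_ (herr.trans_eq ?_) (hdrift.trans_eq ?_) ?_
    · rw [smul_apply, inner_smul_right, hαk]
      calc _ = γ * (k + 1) * (‖∑ i ∈ Finset.Icc 1 m, g i (x (k + 1) 1)‖ ^ 2 / (L * (k + 1))) := by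
            field_simp
        _ ≤ _ := by
            gcongr
            exact le_inner_toEuclideanCLM_inv hck (hlow' m hmm) (by positivity) hupp' _
    · rw [hD₁, hD₂]
      ring
    · rw [hD₃]
      ring
    · have h1 : D₁ / ((k : ℝ) + 1) ≤ 1 / (4 * L) := by
        have h2 : (k₀ : ℝ) ≤ k := by exact_mod_cast (by omega : k₀ ≤ k)
        rw [div_le_div_iff₀ hkpos (by positivity)]
        linarith
      calc γ * (D₁ / (k + 1)) + γ ^ 2 * D₂ + L * (γ * D₃) ^ 2
          = γ * (D₁ / (k + 1) + γ * (D₂ + L * D₃ ^ 2)) := by ring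
        _ ≤ γ * (1 / (4 * L) + 1 / (4 * L)) := by gcongr
        _ = γ / (2 * L) := by field_simp; norm_num
  have hq : 0 < γ * (m * c) ^ 2 / (2 * L ^ 2) := by positivity
  have hq1 : γ * (m * c) ^ 2 / (2 * L ^ 2) < 1 := by
    rw [div_lt_one (by positivity)]
    have h : (m * c) ^ 2 ≤ L ^ 2 := by rw [hLdef]; gcongr
    nlinarith [sq_pos_of_pos hL]
  set q : ℝ := 1 - γ * (m * c) ^ 2 / (2 * L ^ 2) with hqdef
  have hq0 : 0 < q := by linarith
  obtain ⟨B, hB, hVB⟩ := exists_le_mul_pow_of_eventually_le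
    (V := fun k => ∑ i ∈ Finset.Icc 1 m, f i (x k 1) - ∑ i ∈ Finset.Icc 1 m, f i xstar) hq0 hdecr
  refine ⟨√(4 * L * B) / (m * c), √q, by positivity, by positivity,
    (Real.sqrt_lt' one_pos).2 (by linarith), fun k _ => ?_⟩
  rw [div_mul_eq_mul_div, le_div_iff₀' hμ]
  refine (mul_norm_sub_le_norm_gradient hFgrad hGmono hmin (x k 1)).trans ?_
  refine le_of_sq_le_sq ?_ (by positivity)
  rw [mul_pow, Real.sq_sqrt (by positivity), ← pow_mul, mul_comm k 2, pow_mul,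
    Real.sq_sqrt hq0.le, mul_assoc]
  refine (norm_sq_gradient_le hL hFgrad hGlip hmin (x k 1)).trans ?_
  gcongr
  exact hVB k
end
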